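/- Let H be a Hopf algebra and γ a 2-cocycle on H. The linear map u_γ : H → K, h ↦ γ(h₍₁₎ ⊗ S(h₍₂₎)), is convolution invertible with inverse ū_γ : h ↦ γ̄(S(h₍₁₎) ⊗ h₍₂₎), i.e., u_γ(h₍₁₎) ū_γ(h₍₂₎) = ε(h) = ū_γ(h₍₁₎) u_γ(h₍₂₎) for all h ∈ H. -/

import Mathlib

open TensorProduct LinearMap

noncomputable section

variable (R H : Type*) [CommRing R] [Ring H] [HopfAlgebra R H]

/-- The multiplication of `H` as a linear map. -/
abbrev mulH : H ⊗[R] H →ₗ[R] H := LinearMap.mul' R H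

/-- The antipode of `H`. -/
abbrev Sa : H →ₗ[R] H := HopfAlgebra.antipode (R := R)

/-- The comultiplication `h ⊗ k ↦ (h₍₁₎ ⊗ k₍₁₎) ⊗ (h₍₂₎ ⊗ k₍₂₎)` on `H ⊗ H`. -/
def comul2 : H ⊗[R] H →ₗ[R] (H ⊗[R] H) ⊗[R] (H ⊗[R] H) :=
  (tensorTensorTensorComm R H H H H).toLinearMap ∘ₗ map (Coalgebra.comul (R := R)) (Coalgebra.comul (R := R))

/-- The (Coalgebra.counit (R := R)) `h ⊗ k ↦ ε(h)ε(k)` on `H ⊗ H`. -/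
def counit2 : H ⊗[R] H →ₗ[R] R :=
  (TensorProduct.lid R R).toLinearMap ∘ₗ map (Coalgebra.counit (R := R)) (Coalgebra.counit (R := R))

/-- Iterated comultiplication `h ↦ (h₍₁₎ ⊗ h₍₂₎) ⊗ h₍₃₎`. -/
def comul3 : H →ₗ[R] (H ⊗[R] H) ⊗[R] H := map (Coalgebra.comul (R := R)) LinearMap.id ∘ₗ (Coalgebra.comul (R := R))

/-- Iterated comultiplication `h ↦ ((h₍₁₎ ⊗ h₍₂₎) ⊗ h₍₃₎) ⊗ h₍₄₎`. -/
def comul4 : H →ₗ[R] ((H ⊗[R] H) ⊗[R] H) ⊗[R] H := map (comul3 R H) LinearMap.id ∘ₗ (Coalgebra.comul (R := R))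

/-- Convolution product of two functionals with respect to a given comultiplication. -/
def convOn {C : Type*} [AddCommMonoid C] [Module R C]
    (Δc : C →ₗ[R] C ⊗[R] C) (f g : C →ₗ[R] R) : C →ₗ[R] R :=
  LinearMap.mul' R R ∘ₗ map f g ∘ₗ Δc

/-- The comultiplication on the triple tensor product `(H ⊗ H) ⊗ H`. -/
def comulC3 : (H ⊗[R] H) ⊗[R] H →ₗ[R] ((H ⊗[R] H) ⊗[R] H) ⊗[R] ((H ⊗[R] H) ⊗[R] H) :=
  (tensorTensorTensorComm R (H ⊗[R] H) (H ⊗[R] H) H H).toLinearMap ∘ₗ map (comul2 R H) (Coalgebra.comul (R := R))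

/-- `γ` is a 2-cocycle with convolution inverse `γ'` relative to the product `μ`:
convolution invertible, unital, and satisfying the 2-cocycle condition
`γ(g₍₁₎⊗h₍₁₎)γ(g₍₂₎h₍₂₎⊗k) = γ(h₍₁₎⊗k₍₁₎)γ(g⊗h₍₂₎k₍₂₎)`. -/
structure IsCocycle (μ : H ⊗[R] H →ₗ[R] H) (γ γ' : H ⊗[R] H →ₗ[R] R) : Prop where
  cocycle : convOn R (comulC3 R H) (LinearMap.mul' R R ∘ₗ map γ (Coalgebra.counit (R := R))) (γ ∘ₗ map μ LinearMap.id)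
    = convOn R (comulC3 R H)
        (LinearMap.mul' R R ∘ₗ map (Coalgebra.counit (R := R)) γ ∘ₗ (TensorProduct.assoc R H H H).toLinearMap)
        (γ ∘ₗ map LinearMap.id μ ∘ₗ (TensorProduct.assoc R H H H).toLinearMap)
  conv_inv_right : convOn R (comul2 R H) γ γ' = counit2 R H
  conv_inv_left : convOn R (comul2 R H) γ' γ = counit2 R H
  unital_right : ∀ h : H, γ (h ⊗ₜ[R] 1) = (Coalgebra.counit (R := R)) h
  unital_left : ∀ h : H, γ (1 ⊗ₜ[R] h) = (Coalgebra.counit (R := R)) h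

/-- The twisted product `h ·_γ k = γ(h₍₁₎⊗k₍₁₎) h₍₂₎∙k₍₂₎ γ'(h₍₃₎⊗k₍₃₎)`, where `∙` is
the (possibly already deformed) product `μ`. -/
def twistMul (μ : H ⊗[R] H →ₗ[R] H) (γ γ' : H ⊗[R] H →ₗ[R] R) : H ⊗[R] H →ₗ[R] H :=
  (TensorProduct.lid R H).toLinearMap ∘ₗ (TensorProduct.rid R (R ⊗[R] H)).toLinearMap
    ∘ₗ map (map γ μ) γ' ∘ₗ map (comul2 R H) LinearMap.id ∘ₗ comul2 R H

/-- `u_γ(h) = γ(h₍₁₎ ⊗ S(h₍₂₎))`. -/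
def uMap (γ : H ⊗[R] H →ₗ[R] R) : H →ₗ[R] R :=
  γ ∘ₗ map LinearMap.id (Sa R H) ∘ₗ (Coalgebra.comul (R := R))

/-- `ū_γ(h) = γ'(S(h₍₁₎) ⊗ h₍₂₎)`. -/
def ubarMap (γ' : H ⊗[R] H →ₗ[R] R) : H →ₗ[R] R :=
  γ' ∘ₗ map (Sa R H) LinearMap.id ∘ₗ (Coalgebra.comul (R := R))

/-- The twisted antipode `S_γ(h) = u_γ(h₍₁₎) S(h₍₂₎) ū_γ(h₍₃₎)`. -/
def Stw (γ γ' : H ⊗[R] H →ₗ[R] R) : H →ₗ[R] H :=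
  (TensorProduct.lid R H).toLinearMap ∘ₗ (TensorProduct.rid R (R ⊗[R] H)).toLinearMap
    ∘ₗ map (map (uMap R H γ) (Sa R H)) (ubarMap R H γ') ∘ₗ comul3 R H

/-- The (generalized) right adjoint coaction `h ↦ h₍₂₎ ⊗ S'(h₍₁₎) ∙ h₍₃₎`. -/
def AdGen (S' : H →ₗ[R] H) (μ : H ⊗[R] H →ₗ[R] H) : H →ₗ[R] H ⊗[R] H :=
  map LinearMap.id μ ∘ₗ (TensorProduct.assoc R H H H).toLinearMap
    ∘ₗ map ((TensorProduct.comm R H H).toLinearMap ∘ₗ map S' LinearMap.id) LinearMap.id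
    ∘ₗ comul3 R H

/-- The right adjoint coaction `Ad(h) = h₍₂₎ ⊗ S(h₍₁₎)h₍₃₎`. -/
def Ad : H →ₗ[R] H ⊗[R] H := AdGen R H (Sa R H) (mulH R H)

end

section

open Coalgebra WithConv HopfAlgebra
open Algebra.TensorProduct (includeLeft includeRight)

section Convolution

variable {R H A B : Type*} [CommRing R] [Ring H] [HopfAlgebra R H]
  [Semiring A] [Algebra R A] [Semiring B] [Algebra R B]

/-- An algebra homomorphism out of `H`, as an element of the convolution algebra. -/
noncomputable def convOfAlgHom (f : H →ₐ[R] A) : WithConv (H →ₗ[R] A) := toConv f.toLinearMap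

/-- The composite of an algebra homomorphism with the antipode, as an element of the
convolution algebra. -/
noncomputable def convAntipode (f : H →ₐ[R] A) : WithConv (H →ₗ[R] A) :=
  toConv (f.toLinearMap ∘ₗ antipode R)

@[simp]
lemma convOfAlgHom_apply (f : H →ₐ[R] A) (h : H) : convOfAlgHom f h = f h := rfl

@[simp]
lemma convAntipode_apply (f : H →ₐ[R] A) (h : H) : convAntipode f h = f (antipode R h) := rfl

lemma convOfAlgHom_mul_convAntipode (f : H →ₐ[R] A) :
    convOfAlgHom f * convAntipode f = 1 := by
  ext h
  simp [(ℛ R h).convMul_apply, ← map_mul, ← map_sum, sum_mul_antipode_eq_algebraMap_counit]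

lemma convAntipode_mul_convOfAlgHom (f : H →ₐ[R] A) :
    convAntipode f * convOfAlgHom f = 1 := by
  ext h
  simp [(ℛ R h).convMul_apply, ← map_mul, ← map_sum, sum_antipode_mul_eq_algebraMap_counit]

/-- Composition with an algebra homomorphism is multiplicative on convolution algebras. -/
lemma toConv_comp_convMul (F : A →ₐ[R] B) (f g : WithConv (H →ₗ[R] A)) :
    toConv (F.toLinearMap ∘ₗ (f * g).ofConv) =
      toConv (F.toLinearMap ∘ₗ f.ofConv) * toConv (F.toLinearMap ∘ₗ g.ofConv) := by
  rw [algHom_comp_convMul_distrib]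

/-- The antipode reverses factorizations in the convolution algebra. -/
lemma convAntipode_eq_mul {f p q : H →ₐ[R] A}
    (h : convOfAlgHom f = convOfAlgHom p * convOfAlgHom q) :
    convAntipode f = convAntipode q * convAntipode p := by
  refine left_inv_eq_right_inv (convAntipode_mul_convOfAlgHom f) ?_
  rw [h, mul_assoc, ← mul_assoc (convOfAlgHom q), convOfAlgHom_mul_convAntipode, one_mul,
    convOfAlgHom_mul_convAntipode]

/-- Sixfold convolution products agree under linear maps which agree on sixfold products. -/
lemma convMul_six_congr {M : Type*} [AddCommMonoid M] [Module R M]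
    (L : A →ₗ[R] M) (L' : B →ₗ[R] M)
    (f₁ f₂ f₃ f₄ f₅ f₆ : WithConv (H →ₗ[R] A)) (g₁ g₂ g₃ g₄ g₅ g₆ : WithConv (H →ₗ[R] B))
    (hfg : ∀ a b c d e f, L (f₁ a * (f₂ b * (f₃ c * (f₄ d * (f₅ e * f₆ f))))) =
      L' (g₁ a * (g₂ b * (g₃ c * (g₄ d * (g₅ e * g₆ f)))))) (h : H) :
    L ((f₁ * (f₂ * (f₃ * (f₄ * (f₅ * f₆))))) h) =
      L' ((g₁ * (g₂ * (g₃ * (g₄ * (g₅ * g₆))))) h) := by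
  simp only [(ℛ R _).convMul_apply, Finset.mul_sum, map_sum, hfg]

end Convolution

section Tensor

variable (R H : Type*) [CommRing R] [Ring H] [HopfAlgebra R H]

/-- The embedding of `H` as the first tensor factor of `(H ⊗ H) ⊗ H`. -/
noncomputable def incl₁ : H →ₐ[R] (H ⊗[R] H) ⊗[R] H := includeLeft.comp includeLeft

/-- The embedding of `H` as the second tensor factor of `(H ⊗ H) ⊗ H`. -/
noncomputable def incl₂ : H →ₐ[R] (H ⊗[R] H) ⊗[R] H := includeLeft.comp includeRight

/-- The embedding of `H` as the last tensor factor of `(H ⊗ H) ⊗ H`. -/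
noncomputable def incl₃ : H →ₐ[R] (H ⊗[R] H) ⊗[R] H := includeRight

variable {R H}

@[simp] lemma incl₁_apply (h : H) : incl₁ R H h = (h ⊗ₜ 1) ⊗ₜ 1 := rfl
@[simp] lemma incl₂_apply (h : H) : incl₂ R H h = (1 ⊗ₜ h) ⊗ₜ 1 := rfl
@[simp] lemma incl₃_apply (h : H) : incl₃ R H h = 1 ⊗ₜ h := rfl

/-- The first copy of an algebra in its tensor square, precomposed. -/
noncomputable abbrev inL {A : Type*} [Semiring A] [Algebra R A] (f : H →ₐ[R] A) :
    H →ₐ[R] A ⊗[R] A :=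
  includeLeft.comp f

/-- The second copy of an algebra in its tensor square, precomposed. -/
noncomputable abbrev inR {A : Type*} [Semiring A] [Algebra R A] (f : H →ₐ[R] A) :
    H →ₐ[R] A ⊗[R] A :=
  includeRight.comp f

/-- For a bialgebra morphism `f`, `Δ ∘ f` is the convolution product of the two copies of `f`. -/
lemma convOfAlgHom_comulAlgHom_comp {A : Type*} [Semiring A] [Bialgebra R A] (f : H →ₐ[R] A)
    (hf : ∀ h, comul (R := R) (f h) = map f.toLinearMap f.toLinearMap (comul h)) :
    convOfAlgHom ((Bialgebra.comulAlgHom R A).comp f) =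
      convOfAlgHom (inL f) * convOfAlgHom (inR f) := by
  ext h
  simp [(ℛ R h).convMul_apply, hf, ← (ℛ R h).eq]

lemma comul_incl₁ (h : H) : comul (R := R) (incl₁ R H h) =
    map (incl₁ R H).toLinearMap (incl₁ R H).toLinearMap (comul h) := by
  simp [← (ℛ R h).eq, sum_tmul, map_sum, Algebra.TensorProduct.one_def]

lemma comul_incl₂ (h : H) : comul (R := R) (incl₂ R H h) =
    map (incl₂ R H).toLinearMap (incl₂ R H).toLinearMap (comul h) := by
  simp [← (ℛ R h).eq, sum_tmul, tmul_sum, map_sum, Algebra.TensorProduct.one_def]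

lemma comul_incl₃ (h : H) : comul (R := R) (incl₃ R H h) =
    map (incl₃ R H).toLinearMap (incl₃ R H).toLinearMap (comul h) := by
  simp [← (ℛ R h).eq, tmul_sum, map_sum, Algebra.TensorProduct.one_def]

/-- The comultiplication of `h₍₁₎ ⊗ S(h₍₂₎) ⊗ h₍₃₎`. -/
lemma comul_id_antipode_id (h : H) :
    comul (R := R) ((convOfAlgHom (incl₁ R H) * (convAntipode (incl₂ R H) *
        convOfAlgHom (incl₃ R H))) h) =
      (convOfAlgHom (inL (incl₁ R H)) * (convOfAlgHom (inR (incl₁ R H)) *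
        (convAntipode (inR (incl₂ R H)) * (convAntipode (inL (incl₂ R H)) *
          (convOfAlgHom (inL (incl₃ R H)) * convOfAlgHom (inR (incl₃ R H))))))) h := by
  have key := toConv_comp_convMul (Bialgebra.comulAlgHom R ((H ⊗[R] H) ⊗[R] H))
    (convOfAlgHom (incl₁ R H)) (convAntipode (incl₂ R H) * convOfAlgHom (incl₃ R H))
  rw [toConv_comp_convMul _ (convAntipode _)] at key
  change _ = convOfAlgHom ((Bialgebra.comulAlgHom R _).comp (incl₁ R H)) *
    (convAntipode ((Bialgebra.comulAlgHom R _).comp (incl₂ R H)) *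
      convOfAlgHom ((Bialgebra.comulAlgHom R _).comp (incl₃ R H))) at key
  rw [convAntipode_eq_mul (convOfAlgHom_comulAlgHom_comp _ comul_incl₂),
    convOfAlgHom_comulAlgHom_comp _ comul_incl₁,
    convOfAlgHom_comulAlgHom_comp _ comul_incl₃] at key
  simp only [mul_assoc] at key
  exact congr($key h)

/-- The comultiplication of `S(h₍₁₎) ⊗ h₍₂₎ ⊗ S(h₍₃₎)`. -/
lemma comul_antipode_id_antipode (h : H) :
    comul (R := R) ((convAntipode (incl₁ R H) * (convOfAlgHom (incl₂ R H) *
        convAntipode (incl₃ R H))) h) =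
      (convAntipode (inR (incl₁ R H)) * (convAntipode (inL (incl₁ R H)) *
        (convOfAlgHom (inL (incl₂ R H)) * (convOfAlgHom (inR (incl₂ R H)) *
          (convAntipode (inR (incl₃ R H)) * convAntipode (inL (incl₃ R H))))))) h := by
  have key := toConv_comp_convMul (Bialgebra.comulAlgHom R ((H ⊗[R] H) ⊗[R] H))
    (convAntipode (incl₁ R H)) (convOfAlgHom (incl₂ R H) * convAntipode (incl₃ R H))
  rw [toConv_comp_convMul _ (convOfAlgHom _)] at key
  change _ = convAntipode ((Bialgebra.comulAlgHom R _).comp (incl₁ R H)) *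
    (convOfAlgHom ((Bialgebra.comulAlgHom R _).comp (incl₂ R H)) *
      convAntipode ((Bialgebra.comulAlgHom R _).comp (incl₃ R H))) at key
  rw [convAntipode_eq_mul (convOfAlgHom_comulAlgHom_comp _ comul_incl₁),
    convOfAlgHom_comulAlgHom_comp _ comul_incl₂,
    convAntipode_eq_mul (convOfAlgHom_comulAlgHom_comp _ comul_incl₃)] at key
  simp only [mul_assoc] at key
  exact congr($key h)

variable (R H) in
lemma comul2_eq_comul : comul2 R H = comul := by
  ext; simp [comul2, AlgebraTensorModule.tensorTensorTensorComm_eq]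

variable (R H) in
lemma comulC3_eq_comul : comulC3 R H = comul := by
  rw [comulC3, comul2_eq_comul]
  ext; simp [AlgebraTensorModule.tensorTensorTensorComm_eq]

variable (R H) in
lemma counit2_eq_counit : counit2 R H = counit := by
  ext; simp [counit2, mul_comm]

lemma toConv_convOn {C : Type*} [AddCommGroup C] [Module R C] [Coalgebra R C] (f g : C →ₗ[R] R) :
    toConv (convOn R comul f g) = toConv f * toConv g := rfl

/-- Evaluation of a convolution product of functionals at `h₍₁₎ ⊗ S(h₍₂₎) ⊗ h₍₃₎`. -/
lemma convMul_apply_id_antipode_id {B : Type*} [Semiring B] [Algebra R B]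
    {F G : (H ⊗[R] H) ⊗[R] H →ₗ[R] R} (L : B →ₗ[R] R)
    (g₁ g₂ g₃ g₄ g₅ g₆ : WithConv (H →ₗ[R] B))
    (hL : ∀ a b c d e f, F ((a ⊗ₜ antipode R d) ⊗ₜ e) * G ((b ⊗ₜ antipode R c) ⊗ₜ f) =
      L (g₁ a * (g₂ b * (g₃ c * (g₄ d * (g₅ e * g₆ f)))))) (h : H) :
    (toConv F * toConv G) ((convOfAlgHom (incl₁ R H) * (convAntipode (incl₂ R H) *
        convOfAlgHom (incl₃ R H))) h) =
      L ((g₁ * (g₂ * (g₃ * (g₄ * (g₅ * g₆))))) h) := by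
  change (mul' R R ∘ₗ map F G) (comul _) = _
  rw [comul_id_antipode_id]
  refine convMul_six_congr (A := ((H ⊗[R] H) ⊗[R] H) ⊗[R] ((H ⊗[R] H) ⊗[R] H))
    (mul' R R ∘ₗ map F G) L _ _ _ _ _ _ _ _ _ _ _ _
    (fun a b c d e f ↦ ?_) h
  rw [← hL]
  simp [Algebra.TensorProduct.one_def]

/-- Evaluation of a convolution product of functionals at `S(h₍₁₎) ⊗ h₍₂₎ ⊗ S(h₍₃₎)`. -/
lemma convMul_apply_antipode_id_antipode {B : Type*} [Semiring B] [Algebra R B]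
    {F G : (H ⊗[R] H) ⊗[R] H →ₗ[R] R} (L : B →ₗ[R] R)
    (g₁ g₂ g₃ g₄ g₅ g₆ : WithConv (H →ₗ[R] B))
    (hL : ∀ a b c d e f, F ((antipode R b ⊗ₜ c) ⊗ₜ antipode R f) *
        G ((antipode R a ⊗ₜ d) ⊗ₜ antipode R e) =
      L (g₁ a * (g₂ b * (g₃ c * (g₄ d * (g₅ e * g₆ f)))))) (h : H) :
    (toConv F * toConv G) ((convAntipode (incl₁ R H) * (convOfAlgHom (incl₂ R H) *
        convAntipode (incl₃ R H))) h) =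
      L ((g₁ * (g₂ * (g₃ * (g₄ * (g₅ * g₆))))) h) := by
  change (mul' R R ∘ₗ map F G) (comul _) = _
  rw [comul_antipode_id_antipode]
  refine convMul_six_congr (A := ((H ⊗[R] H) ⊗[R] H) ⊗[R] ((H ⊗[R] H) ⊗[R] H))
    (mul' R R ∘ₗ map F G) L _ _ _ _ _ _ _ _ _ _ _ _
    (fun a b c d e f ↦ ?_) h
  rw [← hL]
  simp [Algebra.TensorProduct.one_def]

variable (R H) in
/-- Multiplication of the first two factors, as a coalgebra morphism. -/
noncomputable def mulLeftHom : (H ⊗[R] H) ⊗[R] H →ₗc[R] H ⊗[R] H :=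
  Coalgebra.TensorProduct.map (Bialgebra.mulCoalgHom R H) (CoalgHom.id R H)

variable (R H) in
/-- Multiplication of the last two factors, as a coalgebra morphism. -/
noncomputable def mulRightHom : (H ⊗[R] H) ⊗[R] H →ₗc[R] H ⊗[R] H :=
  (Coalgebra.TensorProduct.map (CoalgHom.id R H) (Bialgebra.mulCoalgHom R H)).comp
    (Coalgebra.TensorProduct.assoc R R H H H).toCoalgHom

variable (R H) in
/-- The counit on the last factor, as a coalgebra morphism. -/
noncomputable def counitRightHom : (H ⊗[R] H) ⊗[R] H →ₗc[R] H ⊗[R] H :=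
  (Coalgebra.TensorProduct.rid R R (H ⊗[R] H)).toCoalgHom.comp
    (Coalgebra.TensorProduct.map (CoalgHom.id R _) (counitCoalgHom R H))

variable (R H) in
/-- The counit on the first factor, as a coalgebra morphism. -/
noncomputable def counitLeftHom : (H ⊗[R] H) ⊗[R] H →ₗc[R] H ⊗[R] H :=
  ((Coalgebra.TensorProduct.lid R (H ⊗[R] H)).toCoalgHom.comp
    (Coalgebra.TensorProduct.map (counitCoalgHom R H) (CoalgHom.id R _))).comp
    (Coalgebra.TensorProduct.assoc R R H H H).toCoalgHom

@[simp] lemma mulLeftHom_tmul (a b c : H) :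
    mulLeftHom R H ((a ⊗ₜ b) ⊗ₜ c) = (a * b) ⊗ₜ c := rfl
@[simp] lemma mulRightHom_tmul (a b c : H) :
    mulRightHom R H ((a ⊗ₜ b) ⊗ₜ c) = a ⊗ₜ (b * c) := rfl
@[simp] lemma counitRightHom_tmul (a b c : H) :
    counitRightHom R H ((a ⊗ₜ b) ⊗ₜ c) = counit (R := R) c • (a ⊗ₜ b) := rfl
@[simp] lemma counitLeftHom_tmul (a b c : H) :
    counitLeftHom R H ((a ⊗ₜ b) ⊗ₜ c) = counit (R := R) a • (b ⊗ₜ c) := rfl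

/-- Pulling back along a coalgebra morphism preserves convolution inverses. -/
lemma conv_comp_coalgHom_eq_one {C D : Type*} [AddCommGroup C] [Module R C] [Coalgebra R C]
    [AddCommGroup D] [Module R D] [Coalgebra R D] (F : C →ₗc[R] D) {f g : D →ₗ[R] R}
    (h : toConv f * toConv g = 1) :
    toConv (f ∘ₗ F.toLinearMap) * toConv (g ∘ₗ F.toLinearMap) = 1 := by
  have := convMul_comp_coalgHom_distrib (toConv f) (toConv g) F
  rw [h] at this
  ext c
  have h2 := congr($this c)
  simpa using h2.symm

namespace IsCocycle

variable {γ γ' : H ⊗[R] H →ₗ[R] R}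

lemma toConv_mul_toConv (hco : IsCocycle R H (mulH R H) γ γ') : toConv γ * toConv γ' = 1 := by
  have h := hco.conv_inv_right
  rw [comul2_eq_comul, counit2_eq_counit] at h
  exact congr(toConv $h)

lemma toConv_inv_mul_toConv (hco : IsCocycle R H (mulH R H) γ γ') : toConv γ' * toConv γ = 1 := by
  have h := hco.conv_inv_left
  rw [comul2_eq_comul, counit2_eq_counit] at h
  exact congr(toConv $h)

lemma conv_eq (hco : IsCocycle R H (mulH R H) γ γ') :
    toConv (γ ∘ₗ (counitRightHom R H).toLinearMap) * toConv (γ ∘ₗ (mulLeftHom R H).toLinearMap) =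
    toConv (γ ∘ₗ (counitLeftHom R H).toLinearMap) *
      toConv (γ ∘ₗ (mulRightHom R H).toLinearMap) := by
  have h := hco.cocycle
  rw [comulC3_eq_comul] at h
  convert congr(toConv $h) using 1
  · rw [toConv_convOn]
    congr 2
    ext; simp [mul_comm]
  · rw [toConv_convOn]
    congr 2
    ext; simp

/-- `γ̄(h₍₁₎ ⊗ k) γ(g ⊗ h₍₂₎) = γ(g₍₁₎ ⊗ h₍₁₎k₍₁₎) γ̄(g₍₂₎h₍₂₎ ⊗ k₍₂₎)`. -/
lemma conv_counitLeft_counitRight (hco : IsCocycle R H (mulH R H) γ γ') :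
    toConv (γ' ∘ₗ (counitLeftHom R H).toLinearMap) *
      toConv (γ ∘ₗ (counitRightHom R H).toLinearMap) =
    toConv (γ ∘ₗ (mulRightHom R H).toLinearMap) *
      toConv (γ' ∘ₗ (mulLeftHom R H).toLinearMap) := by
  rw [← mul_one (toConv (γ ∘ₗ (counitRightHom R H).toLinearMap)),
    ← conv_comp_coalgHom_eq_one (mulLeftHom R H) hco.toConv_mul_toConv,
    ← mul_assoc (toConv (γ ∘ₗ (counitRightHom R H).toLinearMap)), hco.conv_eq,
    ← mul_assoc, ← mul_assoc,
    conv_comp_coalgHom_eq_one (counitLeftHom R H) hco.toConv_inv_mul_toConv, one_mul]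

/-- `γ̄(g ⊗ h₍₁₎) γ(h₍₂₎ ⊗ k) = γ(g₍₁₎h₍₁₎ ⊗ k₍₁₎) γ̄(g₍₂₎ ⊗ h₍₂₎k₍₂₎)`. -/
lemma conv_counitRight_counitLeft (hco : IsCocycle R H (mulH R H) γ γ') :
    toConv (γ' ∘ₗ (counitRightHom R H).toLinearMap) *
      toConv (γ ∘ₗ (counitLeftHom R H).toLinearMap) =
    toConv (γ ∘ₗ (mulLeftHom R H).toLinearMap) *
      toConv (γ' ∘ₗ (mulRightHom R H).toLinearMap) := by
  rw [← mul_one (toConv (γ ∘ₗ (counitLeftHom R H).toLinearMap)),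
    ← conv_comp_coalgHom_eq_one (mulRightHom R H) hco.toConv_mul_toConv,
    ← mul_assoc (toConv (γ ∘ₗ (counitLeftHom R H).toLinearMap)), ← hco.conv_eq,
    ← mul_assoc, ← mul_assoc,
    conv_comp_coalgHom_eq_one (counitRightHom R H) hco.toConv_inv_mul_toConv, one_mul]

lemma inv_unital_left (hco : IsCocycle R H (mulH R H) γ γ') (h : H) : γ' (1 ⊗ₜ[R] h) = counit (R := R) h := by
  have key := congr($(hco.toConv_mul_toConv) (1 ⊗ₜ[R] h))
  simp only [convMul_apply, convOne_apply, comul_tmul, Bialgebra.comul_one,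
    ← (ℛ R h).eq, tmul_sum, map_sum, Algebra.TensorProduct.one_def,
    AlgebraTensorModule.tensorTensorTensorComm_tmul, map_tmul, mul'_apply, hco.unital_left] at key
  have hu := congr(γ' (1 ⊗ₜ[R] $(Coalgebra.sum_counit_smul (ℛ R h))))
  simp only [tmul_sum, map_sum, tmul_smul, map_smul, smul_eq_mul] at hu
  rw [← hu]
  simpa using key

lemma inv_unital_right (hco : IsCocycle R H (mulH R H) γ γ') (h : H) : γ' (h ⊗ₜ[R] 1) = counit (R := R) h := by
  have key := congr($(hco.toConv_mul_toConv) (h ⊗ₜ[R] 1))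
  simp only [convMul_apply, convOne_apply, comul_tmul, Bialgebra.comul_one,
    ← (ℛ R h).eq, sum_tmul, map_sum, Algebra.TensorProduct.one_def,
    AlgebraTensorModule.tensorTensorTensorComm_tmul, map_tmul, mul'_apply, hco.unital_right] at key
  have hu := congr(γ' ($(Coalgebra.sum_counit_smul (ℛ R h)) ⊗ₜ[R] 1))
  simp only [sum_tmul, map_sum, ← smul_tmul', map_smul, smul_eq_mul] at hu
  rw [← hu]
  simpa using key

lemma uMap_convMul_ubarMap (hco : IsCocycle R H (mulH R H) γ γ') :
    toConv (uMap R H γ) * toConv (ubarMap R H γ') = 1 := by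
  let r₁ := inL (R := R) (H := H) (A := H ⊗[R] H) includeLeft
  let r₂ := inL (R := R) (H := H) (A := H ⊗[R] H) includeRight
  let r₃ := inR (R := R) (H := H) (A := H ⊗[R] H) includeLeft
  let r₄ := inR (R := R) (H := H) (A := H ⊗[R] H) includeRight
  let L := mul' R R ∘ₗ map γ γ'
  ext h
  calc (toConv (uMap R H γ) * toConv (ubarMap R H γ')) h
      = L (((convOfAlgHom r₁ * convAntipode r₂) * (convAntipode r₃ * convOfAlgHom r₄)) h) := by
        simp [(ℛ R _).convMul_apply, L, r₁, r₂, r₃, r₄, uMap, ubarMap, ← (ℛ R _).eq,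
          Finset.sum_mul_sum]
    _ = L ((1 * (convOfAlgHom r₁ * (convAntipode r₂ * (convAntipode r₃ *
          (convOfAlgHom r₄ * 1))))) h) := by
        rw [one_mul, mul_one, mul_assoc]
    _ = L ((convOfAlgHom r₁ * (convOfAlgHom r₃ * (convAntipode r₃ * (convAntipode r₂ *
          (convOfAlgHom r₂ * convOfAlgHom r₄))))) h) := by
        rw [← convMul_apply_id_antipode_id (F := γ' ∘ₗ (counitLeftHom R H).toLinearMap)
            (G := γ ∘ₗ (counitRightHom R H).toLinearMap), hco.conv_counitLeft_counitRight]
        · refine convMul_apply_id_antipode_id L _ _ _ _ _ _ (fun a b c d e f ↦ ?_) h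
          simp [L, r₁, r₂, r₃, r₄]
        · intro a b c d e f
          simp [L, r₁, r₂, r₃, r₄, Algebra.algebraMap_eq_smul_one]
          ring
    _ = L ((convOfAlgHom r₁ * convOfAlgHom r₄) h) := by
        rw [← mul_assoc (convOfAlgHom r₃), ← mul_assoc (convAntipode r₂),
          convOfAlgHom_mul_convAntipode, one_mul, convAntipode_mul_convOfAlgHom, one_mul]
    _ = (1 : WithConv (H →ₗ[R] R)) h := by
        have hu := congr(counit (R := R) $(Coalgebra.sum_counit_smul (ℛ R h)))
        simpa [(ℛ R _).convMul_apply, L, r₁, r₄, Algebra.TensorProduct.one_def,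
          hco.unital_right, hco.inv_unital_left] using hu

lemma ubarMap_convMul_uMap (hco : IsCocycle R H (mulH R H) γ γ') :
    toConv (ubarMap R H γ') * toConv (uMap R H γ) = 1 := by
  let r₁ := inL (R := R) (H := H) (A := H ⊗[R] H) includeLeft
  let r₂ := inL (R := R) (H := H) (A := H ⊗[R] H) includeRight
  let r₃ := inR (R := R) (H := H) (A := H ⊗[R] H) includeLeft
  let r₄ := inR (R := R) (H := H) (A := H ⊗[R] H) includeRight
  let L := mul' R R ∘ₗ map γ' γ
  ext h
  calc (toConv (ubarMap R H γ') * toConv (uMap R H γ)) h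
      = L (((convAntipode r₁ * convOfAlgHom r₂) * (convOfAlgHom r₃ * convAntipode r₄)) h) := by
        simp [(ℛ R _).convMul_apply, L, r₁, r₂, r₃, r₄, uMap, ubarMap, ← (ℛ R _).eq,
          Finset.sum_mul_sum]
    _ = L ((1 * (convAntipode r₁ * (convOfAlgHom r₂ * (convOfAlgHom r₃ *
          (convAntipode r₄ * 1))))) h) := by
        rw [one_mul, mul_one, mul_assoc]
    _ = L ((convAntipode r₁ * (convAntipode r₃ * (convOfAlgHom r₃ * (convOfAlgHom r₂ *
          (convAntipode r₂ * convAntipode r₄))))) h) := by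
        rw [← convMul_apply_antipode_id_antipode (F := γ' ∘ₗ (counitRightHom R H).toLinearMap)
            (G := γ ∘ₗ (counitLeftHom R H).toLinearMap), hco.conv_counitRight_counitLeft]
        · refine convMul_apply_antipode_id_antipode L _ _ _ _ _ _ (fun a b c d e f ↦ ?_) h
          simp [L, r₁, r₂, r₃, r₄, mul_comm]
        · intro a b c d e f
          simp [L, r₁, r₂, r₃, r₄, Algebra.algebraMap_eq_smul_one]
          ring
    _ = L ((convAntipode r₁ * convAntipode r₄) h) := by
        rw [← mul_assoc (convAntipode r₃), ← mul_assoc (convOfAlgHom r₂),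
          convAntipode_mul_convOfAlgHom, one_mul, convOfAlgHom_mul_convAntipode, one_mul]
    _ = (1 : WithConv (H →ₗ[R] R)) h := by
        have hu := congr(counit (R := R) $(Coalgebra.sum_counit_smul (ℛ R h)))
        simpa [(ℛ R _).convMul_apply, L, r₁, r₄, Algebra.TensorProduct.one_def,
          hco.unital_left, hco.inv_unital_right] using hu

end IsCocycle

end Tensor

end

/-- `u_γ(h) = γ(h₍₁₎ ⊗ S(h₍₂₎))` is convolution invertible with inverse
`ū_γ(h) = γ̄(S(h₍₁₎) ⊗ h₍₂₎)`: `u_γ(h₍₁₎) ū_γ(h₍₂₎) = ε(h) = ū_γ(h₍₁₎) u_γ(h₍₂₎)`. -/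
theorem uMap_conv_inverse (R H : Type*) [CommRing R] [Ring H] [HopfAlgebra R H]
    (γ γ' : H ⊗[R] H →ₗ[R] R) (hco : IsCocycle R H (mulH R H) γ γ') :
    convOn R (Coalgebra.comul (R := R)) (uMap R H γ) (ubarMap R H γ')
        = (Coalgebra.counit (R := R) (A := H))
    ∧ convOn R (Coalgebra.comul (R := R)) (ubarMap R H γ') (uMap R H γ)
        = (Coalgebra.counit (R := R) (A := H)) := by
  exact ⟨congr(WithConv.ofConv $(hco.uMap_convMul_ubarMap)),
    congr(WithConv.ofConv $(hco.ubarMap_convMul_uMap))⟩
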